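/- Let m > 0 be an odd integer, let T be an essentially small triangulated category whose suspension functor Σ satisfies Σ^m ≅ Id_T as additive functors, let A be an abelian category, and let F : T → A be a cohomological functor. Then the assignment [X] ↦ Σ_{i=0}^{m−1} (−1)^i [F(Σ^i X)] mod 2K_0(A) extends to a well-defined group homomorphism K_0(T) → K_0(A) ⊗_Z F_2. -/

import Mathlib

open CategoryTheory CategoryTheory.Limits CategoryTheory.Pretriangulated

universe v u

attribute [local instance] CategoryTheory.isIsomorphicSetoid

/-- The isomorphism class of an object. -/
noncomputable def isoClass {C : Type u} [Category.{v} C] (X : C) :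
    Quotient (CategoryTheory.isIsomorphicSetoid C) :=
  Quotient.mk _ X

/-- The Grothendieck group of an abelian category: the free abelian group on
isomorphism classes of objects modulo the relations `[X₁] - [X₂] + [X₃] = 0`
for every short exact sequence `0 → X₁ → X₂ → X₃ → 0`. -/
noncomputable def K0Ab (A : Type u) [Category.{v} A] [Abelian A] : Type u :=
  FreeAbelianGroup (Quotient (CategoryTheory.isIsomorphicSetoid A)) ⧸
    AddSubgroup.closure
      {x | ∃ S : ShortComplex A, S.ShortExact ∧
        x = FreeAbelianGroup.of (isoClass S.X₁) - FreeAbelianGroup.of (isoClass S.X₂) +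
          FreeAbelianGroup.of (isoClass S.X₃)}

noncomputable instance (A : Type u) [Category.{v} A] [Abelian A] :
    AddCommGroup (K0Ab A) :=
  QuotientAddGroup.Quotient.addCommGroup _

/-- The class of an object in the Grothendieck group of an abelian category. -/
noncomputable def K0Ab.mk {A : Type u} [Category.{v} A] [Abelian A] (X : A) : K0Ab A :=
  QuotientAddGroup.mk (FreeAbelianGroup.of (isoClass X))

section Triangulated

variable (T : Type u) [Category.{v} T] [HasZeroObject T] [Preadditive T] [HasShift T ℤ]
  [∀ n : ℤ, (shiftFunctor T n).Additive] [Pretriangulated T]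

/-- The Grothendieck group of a (pre)triangulated category: the free abelian group on
isomorphism classes of objects modulo the relations `[X] - [Y] + [Z] = 0` for every
distinguished triangle `X → Y → Z → ΣX`. -/
noncomputable def K0Tri : Type u :=
  FreeAbelianGroup (Quotient (CategoryTheory.isIsomorphicSetoid T)) ⧸
    AddSubgroup.closure
      {x | ∃ Tr : Triangle T, Tr ∈ distinguishedTriangles ∧
        x = FreeAbelianGroup.of (isoClass Tr.obj₁) - FreeAbelianGroup.of (isoClass Tr.obj₂) +
          FreeAbelianGroup.of (isoClass Tr.obj₃)}

noncomputable instance : AddCommGroup (K0Tri T) :=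
  QuotientAddGroup.Quotient.addCommGroup _

variable {T}

/-- The class of an object in the Grothendieck group of a triangulated category. -/
noncomputable def K0Tri.mk (X : T) : K0Tri T :=
  QuotientAddGroup.mk (FreeAbelianGroup.of (isoClass X))

end Triangulated

/-- The subgroup `2G` of an abelian group `G`. -/
noncomputable def twoSubgroup (G : Type*) [AddCommGroup G] : AddSubgroup G :=
  AddSubgroup.closure (Set.range fun g : G => g + g)

/-- `G ⊗_ℤ 𝔽₂`, realized as the quotient `G/2G` of the abelian group `G`. -/
noncomputable abbrev modTwo (G : Type*) [AddCommGroup G] : Type _ :=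
  G ⧸ twoSubgroup G

/-- The canonical projection `G → G ⊗_ℤ 𝔽₂ = G/2G`. -/
noncomputable def modTwo.mk {G : Type*} [AddCommGroup G] (g : G) : modTwo G :=
  QuotientAddGroup.mk g

lemma isoClass_eq {C : Type u} [Category.{v} C] {X Y : C} (e : X ≅ Y) :
    isoClass X = isoClass Y :=
  Quotient.sound ⟨e⟩

lemma K0Ab.mk_iso {A : Type u} [Category.{v} A] [Abelian A] {X Y : A} (e : X ≅ Y) :
    K0Ab.mk X = K0Ab.mk Y := by
  unfold K0Ab.mk
  rw [isoClass_eq e]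

lemma K0Ab.mk_shortExact {A : Type u} [Category.{v} A] [Abelian A] (S : ShortComplex A)
    (hS : S.ShortExact) : K0Ab.mk S.X₂ = K0Ab.mk S.X₁ + K0Ab.mk S.X₃ := by
  have h : K0Ab.mk S.X₁ - K0Ab.mk S.X₂ + K0Ab.mk S.X₃ = 0 :=
    (QuotientAddGroup.eq_zero_iff _).2 (AddSubgroup.subset_closure ⟨S, hS, rfl⟩)
  have h2 : K0Ab.mk S.X₁ + K0Ab.mk S.X₃ - K0Ab.mk S.X₂ = 0 := by
    rw [← h]; abel
  exact (sub_eq_zero.1 h2).symm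

lemma K0Ab.mk_exact {A : Type u} [Category.{v} A] [Abelian A] (S : ShortComplex A)
    (hS : S.Exact) : K0Ab.mk S.X₁ = K0Ab.mk (kernel S.f) + K0Ab.mk (kernel S.g) := by
  have w : kernel.ι S.f ≫ kernel.lift S.g S.f S.zero = 0 := by
    rw [← cancel_mono (kernel.ι S.g)]
    simp
  have : Epi (kernel.lift S.g S.f S.zero) := hS.epi_kernelLift
  refine K0Ab.mk_shortExact (ShortComplex.mk _ _ w) ?_
  refine { exact := ?_, mono_f := ?_, epi_g := ?_ }
  · apply ShortComplex.exact_of_f_is_kernel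
    refine KernelFork.IsLimit.ofι' _ _ (fun {W} k hk => ⟨kernel.lift S.f k ?_, kernel.lift_ι _ _ _⟩)
    have := congrArg (fun t => t ≫ kernel.ι S.g) hk
    simpa using this
  · dsimp; infer_instance
  · exact this

lemma modTwo.add_self {G : Type*} [AddCommGroup G] (x : modTwo G) : x + x = 0 := by
  obtain ⟨g, rfl⟩ := QuotientAddGroup.mk_surjective x
  exact (QuotientAddGroup.eq_zero_iff (g + g)).2 (AddSubgroup.subset_closure ⟨g, rfl⟩)

lemma modTwo.mk_add {G : Type*} [AddCommGroup G] (x y : G) :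
    modTwo.mk (x + y) = modTwo.mk x + modTwo.mk y := rfl

lemma modTwo.neg_eq {G : Type*} [AddCommGroup G] (x : modTwo G) : -x = x :=
  (eq_neg_of_add_eq_zero_left (modTwo.add_self x)).symm

lemma modTwo.sign_smul {G : Type*} [AddCommGroup G] (i : ℕ) (x : modTwo G) :
    ((-1 : ℤ) ^ i) • x = x := by
  rcases neg_one_pow_eq_or ℤ i with h | h <;> rw [h]
  · simp
  · rw [neg_smul, one_smul, modTwo.neg_eq]

lemma modTwo.sum_telescope {G : Type*} [AddCommGroup G] (k : ℕ → modTwo G) (m : ℕ) :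
    ∑ i ∈ Finset.range m, (k i + k (i + 1)) = k 0 + k m := by
  induction m with
  | zero => simp [modTwo.add_self]
  | succ n ih =>
    rw [Finset.sum_range_succ, ih]
    calc k 0 + k n + (k n + k (n + 1)) = k 0 + k (n + 1) + (k n + k n) := by abel
      _ = _ := by rw [modTwo.add_self, add_zero]

/-- Let `m > 0` be an odd integer, `T` an essentially small triangulated
category with `Σ^m ≅ Id` as additive functors, `A` an abelian category and `F : T ⥤ A`
a cohomological functor.  Then `[X] ↦ ∑_{i=0}^{m-1} (-1)^i [F(Σ^i X)] mod 2K₀(A)`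
extends to a well-defined group homomorphism `K₀(T) → K₀(A) ⊗_ℤ 𝔽₂`. -/
theorem odd_periodic_cohomological_functor_induces_hom_on_K0_mod_two
    {T : Type u} [Category.{v} T] [HasZeroObject T] [Preadditive T] [HasShift T ℤ]
    [∀ n : ℤ, (shiftFunctor T n).Additive] [Pretriangulated T] [EssentiallySmall.{0} T]
    {A : Type*} [Category A] [Abelian A]
    (m : ℕ) (hm₀ : 0 < m) (hm : Odd m)
    (e : shiftFunctor T (m : ℤ) ≅ 𝟭 T)
    (F : T ⥤ A) [F.IsHomological] :
    ∃ φ : K0Tri T →+ modTwo (K0Ab A),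
      ∀ X : T, φ (K0Tri.mk X) =
        ∑ i ∈ Finset.range m, ((-1 : ℤ) ^ i) •
          modTwo.mk (K0Ab.mk (F.obj (X⟦(i : ℤ)⟧))) := by
  classical
  letI : F.ShiftSequence ℤ := Functor.ShiftSequence.tautological F ℤ
  have hshift : ∀ (X : T) (n : ℤ), K0Ab.mk (F.obj (X⟦n⟧)) = K0Ab.mk ((F.shift n).obj X) :=
    fun X n => K0Ab.mk_iso ((F.isoShift n).app X)
  let f : Quotient (CategoryTheory.isIsomorphicSetoid T) → modTwo (K0Ab A) :=
    Quotient.lift (fun X => ∑ i ∈ Finset.range m, ((-1 : ℤ) ^ i) •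
          modTwo.mk (K0Ab.mk (F.obj (X⟦(i : ℤ)⟧)))) (by
      rintro X Y ⟨a⟩
      refine Finset.sum_congr rfl (fun i _ => ?_)
      rw [K0Ab.mk_iso (F.mapIso ((shiftFunctor T (i : ℤ)).mapIso a))])
  have hf : ∀ X : T, f (isoClass X) =
      ∑ i ∈ Finset.range m, modTwo.mk (K0Ab.mk ((F.shift (i : ℤ)).obj X)) := by
    intro X
    refine Finset.sum_congr rfl (fun i _ => ?_)
    rw [modTwo.sign_smul, hshift]
  refine ⟨QuotientAddGroup.lift _ (FreeAbelianGroup.lift f) ?_, ?_⟩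
  · rw [AddSubgroup.closure_le]
    rintro x ⟨Tr, hTr, rfl⟩
    change FreeAbelianGroup.lift f _ = 0
    rw [map_add, map_sub, FreeAbelianGroup.lift_apply_of, FreeAbelianGroup.lift_apply_of,
      FreeAbelianGroup.lift_apply_of, sub_eq_add_neg, modTwo.neg_eq, hf, hf, hf,
      ← Finset.sum_add_distrib, ← Finset.sum_add_distrib]
    let k : ℕ → modTwo (K0Ab A) := fun i =>
      modTwo.mk (K0Ab.mk (kernel ((F.shift (i : ℤ)).map Tr.mor₁)))
    have key : ∀ i : ℕ, modTwo.mk (K0Ab.mk ((F.shift (i : ℤ)).obj Tr.obj₁)) +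
        modTwo.mk (K0Ab.mk ((F.shift (i : ℤ)).obj Tr.obj₂)) +
        modTwo.mk (K0Ab.mk ((F.shift (i : ℤ)).obj Tr.obj₃)) = k i + k (i + 1) := by
      intro i
      have hi : (i : ℤ) + 1 = ((i + 1 : ℕ) : ℤ) := by push_cast; rfl
      have h1 := K0Ab.mk_exact _ (F.homologySequence_exact₂ Tr hTr (i : ℤ))
      have h2 := K0Ab.mk_exact _ (F.homologySequence_exact₃ Tr hTr (i : ℤ) _ hi)
      have h3 := K0Ab.mk_exact _ (F.homologySequence_exact₁ Tr hTr (i : ℤ) _ hi)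
      dsimp only at h1 h2 h3
      rw [h1, h2, h3, modTwo.mk_add, modTwo.mk_add, modTwo.mk_add]
      have cancel : ∀ a b c d : modTwo (K0Ab A), a + b + (b + c) + (c + d) = a + d := by
        intro a b c d
        calc a + b + (b + c) + (c + d) = a + d + (b + b) + (c + c) := by abel
          _ = _ := by rw [modTwo.add_self, modTwo.add_self, add_zero, add_zero]
      exact cancel _ _ _ _
    rw [Finset.sum_congr rfl (fun i _ => key i), modTwo.sum_telescope]
    let E : F.shift (m : ℤ) ≅ F.shift ((0 : ℕ) : ℤ) :=
      (F.isoShift (m : ℤ)).symm ≪≫ Functor.isoWhiskerRight e F ≪≫ F.leftUnitor ≪≫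
        (F.isoShiftZero ℤ).symm
    have hk : k m = k 0 := congrArg modTwo.mk (K0Ab.mk_iso
      (kernel.mapIso _ _ (E.app Tr.obj₁) (E.app Tr.obj₂) (E.hom.naturality Tr.mor₁)))
    rw [hk, modTwo.add_self]
  · intro X
    change FreeAbelianGroup.lift f (FreeAbelianGroup.of (isoClass X)) = _
    rw [FreeAbelianGroup.lift_apply_of]
    rfl
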